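/- arXiv:1903.06004 — 3 statements merged into one kernel-verified Lean document; each statement's English description precedes it below -/
import Mathlib

section
/- Let X be a Polish space with a closed partial order ⪯ (i.e. the set H = {(x, x') ∈ X × X : x ⪯ x'} is closed in the product topology). For probability measures P and P' on the Borel σ-field of X, P is stochastically dominated by P' (∫ f dP ≤ ∫ f dP' for every bounded measurable nondecreasing f : X → ℝ) if and only if there exists a probability measure P̃ on X × X with first marginal P and second marginal P' such that P̃(H) = 1. -/
open MeasureTheory

open scoped CompactlySupported

/-- A linear functional on `C(K, ℝ)`, `K` compact, that is nonnegative on nonnegative functions is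
integration against a finite measure. -/
theorem exists_finiteMeasure_integral_eq
    {K : Type*} [TopologicalSpace K] [CompactSpace K] [T2Space K] [MeasurableSpace K]
    [BorelSpace K] (L : C(K, ℝ) →ₗ[ℝ] ℝ) (hL : ∀ φ : C(K, ℝ), 0 ≤ φ → 0 ≤ L φ) :
    ∃ Q : Measure K, IsFiniteMeasure Q ∧ ∀ φ : C(K, ℝ), ∫ x, φ x ∂Q = L φ := by
  let Λ : C_c(K, ℝ) →ₚ[ℝ] ℝ :=
    { toFun φ := L φ.toContinuousMap
      map_add' φ ψ := L.map_add φ.toContinuousMap ψ.toContinuousMap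
      map_smul' c φ := L.map_smul c φ.toContinuousMap
      monotone' φ ψ hle := by
        have := hL (ψ.toContinuousMap - φ.toContinuousMap) fun x ↦ sub_nonneg.2 (hle x)
        rw [map_sub] at this
        exact sub_nonneg.1 this }
  exact ⟨RealRMK.rieszMeasure Λ, inferInstance, fun φ ↦ RealRMK.integral_rieszMeasure Λ
    ⟨φ, HasCompactSupport.of_compactSpace _⟩⟩

/-- Kantorovich-type duality on compact spaces: if `∫ f dμ ≤ ∫ g dν` whenever `f x ≤ g y` for
all `(x, y) ∈ F`, then `μ` and `ν` have a coupling concentrated on the closed set `F`. -/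
theorem exists_coupling_of_integral_le
    {Y Z : Type*} [TopologicalSpace Y] [CompactSpace Y] [TopologicalSpace.MetrizableSpace Y]
    [MeasurableSpace Y] [BorelSpace Y]
    [TopologicalSpace Z] [CompactSpace Z] [TopologicalSpace.MetrizableSpace Z]
    [MeasurableSpace Z] [BorelSpace Z]
    (μ : Measure Y) (ν : Measure Z) [IsProbabilityMeasure μ] [IsProbabilityMeasure ν]
    {F : Set (Y × Z)} (hF : IsClosed F)
    (h : ∀ (f : C(Y, ℝ)) (g : C(Z, ℝ)), (∀ p ∈ F, f p.1 ≤ g p.2) →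
      ∫ y, f y ∂μ ≤ ∫ z, g z ∂ν) :
    ∃ Q : Measure (Y × Z), IsProbabilityMeasure Q ∧
      Q.map Prod.fst = μ ∧ Q.map Prod.snd = ν ∧ Q Fᶜ = 0 := by
  let := TopologicalSpace.metrizableSpaceMetric Y
  let := TopologicalSpace.metrizableSpaceMetric Z
  have hFne : F.Nonempty := by
    by_contra hne
    rw [Set.not_nonempty_iff_eq_empty] at hne
    have := h 1 0 (by simp [hne])
    norm_num at this
  let T : C(Y, ℝ) × C(Z, ℝ) →ₗ[ℝ] C(Y × Z, ℝ) :=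
    { toFun u := u.1.comp ContinuousMap.fst + u.2.comp ContinuousMap.snd
      map_add' u v := by ext; simp; ring
      map_smul' c u := by ext; simp }
  have hint : ∀ φ : C(Y × Z, ℝ), Integrable φ (μ.prod ν) := fun φ ↦
    φ.continuous.integrable_of_hasCompactSupport (HasCompactSupport.of_compactSpace _)
  let I : C(Y × Z, ℝ) →ₗ[ℝ] ℝ :=
    { toFun φ := ∫ p, φ p ∂μ.prod ν
      map_add' φ ψ := integral_add (hint φ) (hint ψ)
      map_smul' c φ := integral_smul c φ }
  have hIT : ∀ f g, I (T (f, g)) = ∫ y, f y ∂μ + ∫ z, g z ∂ν := by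
    intro f g
    have h1 : ∫ p : Y × Z, f p.1 ∂μ.prod ν = ∫ y, f y ∂μ := by
      simpa using integral_fun_fst (μ := μ) (ν := ν) f
    have h2 : ∫ p : Y × Z, g p.2 ∂μ.prod ν = ∫ z, g z ∂ν := by
      simpa using integral_fun_snd (μ := μ) (ν := ν) g
    rw [← h1, ← h2]
    exact integral_add (hint (f.comp ContinuousMap.fst)) (hint (g.comp ContinuousMap.snd))
  let s : PointedCone ℝ C(Y × Z, ℝ) :=
    { carrier := {φ | ∀ p ∈ F, 0 ≤ φ p}
      add_mem' := fun hφ hψ p hp ↦ add_nonneg (hφ p hp) (hψ p hp)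
      zero_mem' := fun p _ ↦ le_rfl
      smul_mem' := fun c φ hφ p hp ↦ mul_nonneg c.2 (hφ p hp) }
  obtain ⟨L, hLI, hLs⟩ := riesz_extension s ⟨T.range, I.comp T.range.subtype⟩ (by
    rintro ⟨_, ⟨f, g⟩, rfl⟩ hs
    have := h (-f) g fun p hp ↦ by
      have : 0 ≤ f p.1 + g p.2 := hs p hp
      simpa using by linarith
    have hI : 0 ≤ I (T (f, g)) := by
      rw [hIT]
      simp only [ContinuousMap.neg_apply, integral_neg] at this
      linarith
    exact hI) (by
    intro φ
    refine ⟨⟨T (ContinuousMap.const _ ‖φ‖, 0), ⟨_, rfl⟩⟩, fun p _ ↦ ?_⟩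
    have := neg_le_of_abs_le (φ.norm_coe_le_norm p)
    simpa [T] using by linarith)
  have hLT : ∀ f g, L (T (f, g)) = ∫ y, f y ∂μ + ∫ z, g z ∂ν := fun f g ↦
    (hLI ⟨T (f, g), ⟨_, rfl⟩⟩).trans (hIT f g)
  obtain ⟨Q, _, hQ⟩ := exists_finiteMeasure_integral_eq L fun φ hφ ↦ hLs φ fun p _ ↦ hφ p
  have hfst : Q.map Prod.fst = μ := by
    refine ext_of_forall_integral_eq_of_IsFiniteMeasure fun f ↦ ?_
    rw [integral_map measurable_fst.aemeasurable
      f.continuous.measurable.aestronglyMeasurable]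
    have := (hQ (T (f.toContinuousMap, 0))).trans (hLT _ _)
    simpa [T] using this
  have hsnd : Q.map Prod.snd = ν := by
    refine ext_of_forall_integral_eq_of_IsFiniteMeasure fun g ↦ ?_
    rw [integral_map measurable_snd.aemeasurable
      g.continuous.measurable.aestronglyMeasurable]
    have := (hQ (T (0, g.toContinuousMap))).trans (hLT _ _)
    simpa [T] using this
  have hprob : IsProbabilityMeasure Q := by
    constructor
    rw [← Set.preimage_univ (f := Prod.fst), ← Measure.map_apply measurable_fst .univ, hfst]
    exact measure_univ
  refine ⟨Q, hprob, hfst, hsnd, ?_⟩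
  let φ : C(Y × Z, ℝ) := ⟨fun p ↦ Metric.infDist p F, Metric.continuous_infDist_pt F⟩
  have hφ : ∀ p, φ p = 0 ↔ p ∈ F := fun p ↦ (hF.mem_iff_infDist_zero hFne).symm
  have hφ0 : ∫ p, φ p ∂Q = 0 := by
    rw [hQ]
    refine le_antisymm ?_ (hLs φ fun p _ ↦ Metric.infDist_nonneg)
    have := hLs (-φ) fun p hp ↦ by simp [(hφ p).2 hp]
    simpa using this
  rw [integral_eq_zero_iff_of_nonneg (show 0 ≤ ⇑φ from fun p ↦ Metric.infDist_nonneg)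
    (φ.continuous.integrable_of_hasCompactSupport (HasCompactSupport.of_compactSpace _))] at hφ0
  rw [← mem_ae_iff]
  filter_upwards [hφ0] with p hp using (hφ p).1 hp

/-- If `μ {f > t} ≤ ν {g > t}` for all `t`, then `∫ f dμ ≤ ∫ g dν`. -/
theorem integral_le_integral_of_measure_lt_le
    {α β : Type*} [MeasurableSpace α] [MeasurableSpace β] {μ : Measure α} {ν : Measure β}
    [IsProbabilityMeasure μ] [IsProbabilityMeasure ν] {f : α → ℝ} {g : β → ℝ} {C : ℝ}
    (hf : Measurable f) (hg : Measurable g) (hfC : ∀ x, |f x| ≤ C) (hgC : ∀ x, |g x| ≤ C)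
    (h : ∀ t, μ {x | t < f x} ≤ ν {x | t < g x}) :
    ∫ x, f x ∂μ ≤ ∫ x, g x ∂ν := by
  have hfi : Integrable f μ := .of_bound hf.aestronglyMeasurable C (.of_forall hfC)
  have hgi : Integrable g ν := .of_bound hg.aestronglyMeasurable C (.of_forall hgC)
  have hf0 : ∀ x, 0 ≤ f x + C := fun x ↦ by linarith [neg_le_of_abs_le (hfC x)]
  have hg0 : ∀ x, 0 ≤ g x + C := fun x ↦ by linarith [neg_le_of_abs_le (hgC x)]
  have key : ∫ x, (f x + C) ∂μ ≤ ∫ x, (g x + C) ∂ν := by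
    rw [integral_eq_lintegral_of_nonneg_ae (.of_forall hf0) (by fun_prop),
      integral_eq_lintegral_of_nonneg_ae (.of_forall hg0) (by fun_prop)]
    refine ENNReal.toReal_mono
      (hgi.add (integrable_const C)).lintegral_lt_top.ne ?_
    rw [lintegral_eq_lintegral_meas_lt μ (.of_forall hf0) (by fun_prop),
      lintegral_eq_lintegral_meas_lt ν (.of_forall hg0) (by fun_prop)]
    refine lintegral_mono fun t ↦ ?_
    simpa only [sub_lt_iff_lt_add] using h (t - C)
  rw [integral_add hfi (integrable_const C), integral_add hgi (integrable_const C)] at key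
  simpa using key

/-- In a space with closed order, the upper closure of a compact set is closed. -/
theorem IsCompact.isClosed_upperClosure
    {X : Type*} [TopologicalSpace X] [Preorder X] [OrderClosedTopology X] {D : Set X}
    (hD : IsCompact D) : IsClosed (upperClosure D : Set X) := by
  have : CompactSpace D := isCompact_iff_compactSpace.1 hD
  have hE : IsClosed {p : D × X | (p.1 : X) ≤ p.2} :=
    isClosed_le (by fun_prop) (by fun_prop)
  convert isClosedMap_snd_of_compactSpace _ hE using 1
  ext y
  simp [mem_upperClosure]

/-- Stochastic dominance on upper sets gives `∫ f dP ≤ ∫ g dP'` for bounded continuous `f` and `g`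
such that `f x ≤ g y` whenever `x ≤ y`. -/
theorem integral_le_integral_of_forall_isUpperSet
    {X : Type*} [TopologicalSpace X] [PolishSpace X] [MeasurableSpace X] [BorelSpace X]
    [Preorder X] [OrderClosedTopology X]
    {P P' : Measure X} [IsProbabilityMeasure P] [IsProbabilityMeasure P']
    (h : ∀ U : Set X, IsClosed U → IsUpperSet U → P U ≤ P' U)
    {f g : X → ℝ} (hf : Continuous f) (hg : Continuous g) {C : ℝ} (hfC : ∀ x, |f x| ≤ C)
    (hgC : ∀ x, |g x| ≤ C) (hfg : ∀ x y, x ≤ y → f x ≤ g y) :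
    ∫ x, f x ∂P ≤ ∫ x, g x ∂P' := by
  refine integral_le_integral_of_measure_lt_le hf.measurable hg.measurable hfC hgC fun t ↦ ?_
  rw [(isOpen_lt continuous_const hf).measurableSet.measure_eq_iSup_isCompact]
  refine iSup₂_le fun D hDf ↦ iSup_le fun hD ↦ ?_
  calc P D ≤ P (upperClosure D : Set X) := measure_mono subset_upperClosure
    _ ≤ P' (upperClosure D : Set X) := h _ hD.isClosed_upperClosure (upperClosure D).upper
    _ ≤ P' {x | t < g x} := measure_mono fun y ⟨x, hx, hxy⟩ ↦ (hDf hx).trans_le (hfg x y hxy)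

/-- **Strassen's theorem.** Let `X` be a Polish space with a closed partial order
(`OrderClosedTopology` says `{(x, x') | x ≤ x'}` is closed). For probability measures
`P`, `P'` on `X`, one has `∫ f dP ≤ ∫ f dP'` for every bounded measurable nondecreasing
`f : X → ℝ` if and only if there exists a probability measure on `X × X` with marginals
`P` and `P'` that is concentrated on `{(x, x') | x ≤ x'}`. -/
theorem strassen_stochastic_domination
    {X : Type*} [TopologicalSpace X] [PolishSpace X] [MeasurableSpace X] [BorelSpace X]
    [PartialOrder X] [OrderClosedTopology X]
    (P P' : Measure X) [IsProbabilityMeasure P] [IsProbabilityMeasure P'] :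
    (∀ f : X → ℝ, Measurable f → Monotone f → (∃ C, ∀ x, |f x| ≤ C) →
        ∫ x, f x ∂P ≤ ∫ x, f x ∂P') ↔
      ∃ Q : Measure (X × X), IsProbabilityMeasure Q ∧
        Q.map Prod.fst = P ∧ Q.map Prod.snd = P' ∧
        Q {p : X × X | p.1 ≤ p.2} = 1 := by
  have hHcl : IsClosed {p : X × X | p.1 ≤ p.2} := isClosed_le continuous_fst continuous_snd
  constructor
  · intro h
    have hU : ∀ U : Set X, IsClosed U → IsUpperSet U → P U ≤ P' U := by
      intro U hUc hUu
      have := h (U.indicator 1) (measurable_one.indicator hUc.measurableSet)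
        (fun x y hxy ↦ by
          by_cases hx : x ∈ U
          · simp [hx, hUu hxy hx]
          · rw [Set.indicator_of_notMem hx]
            exact Set.indicator_nonneg (fun _ _ ↦ zero_le_one) y)
        ⟨1, fun x ↦ by by_cases hx : x ∈ U <;> simp [hx]⟩
      rw [integral_indicator_one hUc.measurableSet, integral_indicator_one hUc.measurableSet]
        at this
      exact (ENNReal.toReal_le_toReal (measure_ne_top _ _) (measure_ne_top _ _)).1 this
    let := TopologicalSpace.upgradeIsCompletelyMetrizable X
    obtain ⟨i, hi⟩ := Metric.PiNatEmbed.exists_embedding_to_hilbert_cube (X := X)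
    have him : MeasurableEmbedding i := hi.continuous.measurableEmbedding hi.injective
    have hii := hi.prodMap hi
    have hiim : MeasurableEmbedding (Prod.map i i) :=
      hii.continuous.measurableEmbedding hii.injective
    have : IsProbabilityMeasure (P.map i) :=
      Measure.isProbabilityMeasure_map him.measurable.aemeasurable
    have : IsProbabilityMeasure (P'.map i) :=
      Measure.isProbabilityMeasure_map him.measurable.aemeasurable
    obtain ⟨Q, hQ, hQ1, hQ2, hQF⟩ := exists_coupling_of_integral_le (P.map i) (P'.map i)
      (F := closure (Prod.map i i '' {p : X × X | p.1 ≤ p.2})) isClosed_closure (by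
        intro f g hfg
        rw [him.integral_map, him.integral_map]
        refine integral_le_integral_of_forall_isUpperSet hU (C := max ‖f‖ ‖g‖)
          (f.continuous.comp hi.continuous) (g.continuous.comp hi.continuous)
          (fun x ↦ (f.norm_coe_le_norm _).trans (le_max_left _ _))
          (fun x ↦ (g.norm_coe_le_norm _).trans (le_max_right _ _)) fun x y hxy ↦ ?_
        exact hfg (i x, i y) (subset_closure ⟨(x, y), hxy, rfl⟩))
    have hrange : ∀ᵐ p ∂Q, p ∈ Set.range (Prod.map i i) := by
      have h1 : ∀ᵐ p ∂Q, p.1 ∈ Set.range i := by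
        refine ae_of_ae_map measurable_fst.aemeasurable ?_
        rw [hQ1]
        exact (ae_map_iff him.measurable.aemeasurable him.measurableSet_range).2 (by simp)
      have h2 : ∀ᵐ p ∂Q, p.2 ∈ Set.range i := by
        refine ae_of_ae_map measurable_snd.aemeasurable ?_
        rw [hQ2]
        exact (ae_map_iff him.measurable.aemeasurable him.measurableSet_range).2 (by simp)
      filter_upwards [h1, h2] with p h1 h2
      rw [Set.range_prodMap]
      exact ⟨h1, h2⟩
    have hmap : (Q.comap (Prod.map i i)).map (Prod.map i i) = Q := by
      rw [hiim.map_comap, Measure.restrict_eq_self_of_ae_mem hrange]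
    have huniv : (Q.comap (Prod.map i i)) Set.univ = 1 := by
      rw [← Set.preimage_univ (f := Prod.map i i), ← hiim.map_apply, hmap]
      exact measure_univ
    have hinj : ∀ {R R' : Measure X}, R.map i = R'.map i → R = R' := fun {R R'} hR ↦ by
      rw [← him.comap_map R, hR, him.comap_map]
    have hprob : IsProbabilityMeasure (Q.comap (Prod.map i i)) := ⟨huniv⟩
    refine ⟨Q.comap (Prod.map i i), hprob, hinj ?_, hinj ?_, ?_⟩
    · rw [← hQ1, Measure.map_map him.measurable measurable_fst]
      conv_rhs => rw [← hmap, Measure.map_map measurable_fst hiim.measurable]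
      rfl
    · rw [← hQ2, Measure.map_map him.measurable measurable_snd]
      conv_rhs => rw [← hmap, Measure.map_map measurable_snd hiim.measurable]
      rfl
    · rw [← hHcl.closure_eq, hii.closure_eq_preimage_closure_image, ← hiim.map_apply, hmap]
      exact (prob_compl_eq_zero_iff isClosed_closure.measurableSet).1 hQF
  · rintro ⟨Q, hQ, rfl, rfl, hQH⟩ f hf hmono ⟨C, hC⟩
    rw [integral_map measurable_fst.aemeasurable hf.aestronglyMeasurable,
      integral_map measurable_snd.aemeasurable hf.aestronglyMeasurable]
    refine integral_mono_ae
      (.of_bound (hf.comp measurable_fst).aestronglyMeasurable C (.of_forall fun p ↦ hC p.1))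
      (.of_bound (hf.comp measurable_snd).aestronglyMeasurable C (.of_forall fun p ↦ hC p.2)) ?_
    have : ∀ᵐ p ∂Q, p ∈ {p : X × X | p.1 ≤ p.2} :=
      (prob_compl_eq_zero_iff hHcl.measurableSet).2 hQH
    filter_upwards [this] with p hp using hmono hp
end

section
/- Let I be a countable index set and (X_i)_{i∈I} a family of random elements of a partially ordered Polish space X with closed partial order. If for every finite subset J ⊂ I the finite subfamily (X_i)_{i∈J} is positively associated, then the whole family (X_i)_{i∈I} is positively associated: for every subset J ⊂ I and all bounded measurable coordinatewise nondecreasing functions f, g : X^J → ℝ, E[f(X_J) g(X_J)] ≥ E[f(X_J)] E[g(X_J)]. -/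
open MeasureTheory

/-- A family `(Xs i)_{i ∈ ι}` of random elements of a partially ordered measurable space `X`
is *positively associated* if for every index set `J ⊆ ι` and all bounded measurable
coordinatewise nondecreasing `f, g : X^J → ℝ`, one has
`E[f(X_J) g(X_J)] ≥ E[f(X_J)] E[g(X_J)]`. -/
def PosAssoc {Ω ι X : Type*} [MeasurableSpace Ω] [MeasurableSpace X] [Preorder X]
    (P : Measure Ω) (Xs : ι → Ω → X) : Prop :=
  ∀ (J : Set ι) (f g : (J → X) → ℝ),
    Measurable f → Monotone f → (∃ C, ∀ x, |f x| ≤ C) →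
    Measurable g → Monotone g → (∃ C, ∀ x, |g x| ≤ C) →
    (∫ ω, f (fun j => Xs j.1 ω) ∂P) * ∫ ω, g (fun j => Xs j.1 ω) ∂P ≤
      ∫ ω, f (fun j => Xs j.1 ω) * g (fun j => Xs j.1 ω) ∂P

open Filter Topology Set
open scoped ENNReal

/-- The points that dominate some point of `K` on the coordinates in `F`. -/
def upperCylinder {κ X : Type*} [LE X] (K : Set (κ → X)) (F : Finset κ) : Set (κ → X) :=
  {x | ∃ k ∈ K, ∀ j ∈ F, k j ≤ x j}

theorem upperCylinder_antitone {κ X : Type*} [LE X] (K : Set (κ → X)) :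
    Antitone (upperCylinder K) :=
  fun _ _ hFG _ ⟨k, hk, hle⟩ => ⟨k, hk, fun j hj => hle j (hFG hj)⟩

theorem IsCompact.isClosed_setOf_exists_mem {Y Z : Type*} [TopologicalSpace Y]
    [TopologicalSpace Z] {K : Set Y} (hK : IsCompact K) {C : Set (Y × Z)} (hC : IsClosed C) :
    IsClosed {z | ∃ y ∈ K, (y, z) ∈ C} := by
  have : CompactSpace K := isCompact_iff_compactSpace.1 hK
  have h := isClosedMap_snd_of_compactSpace (X := K) (Y := Z)
    ((fun p : K × Z => ((p.1 : Y), p.2)) ⁻¹' C) (hC.preimage (by fun_prop))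
  convert h using 1
  ext z
  simp

/-- The sets `{z | ∃ k ∈ K, ∀ j ∈ F, k j ≤ z (e j)}` are closed when `K` is compact. -/
theorem IsCompact.isClosed_setOf_exists_forall_le {κ κ' X : Type*} [TopologicalSpace X]
    [Preorder X] [OrderClosedTopology X] {K : Set (κ → X)} (hK : IsCompact K)
    (F : Finset κ) (e : F → κ') :
    IsClosed {z : κ' → X | ∃ k ∈ K, ∀ j : F, k j ≤ z (e j)} := by
  refine hK.isClosed_setOf_exists_mem
    (C := {p : (κ → X) × (κ' → X) | ∀ j : F, p.1 j ≤ p.2 (e j)}) ?_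
  simp only [ofPred_forall]
  exact isClosed_iInter fun j => isClosed_le (by fun_prop) (by fun_prop)

theorem IsCompact.isClosed_upperCylinder {κ X : Type*} [TopologicalSpace X]
    [Preorder X] [OrderClosedTopology X] {K : Set (κ → X)} (hK : IsCompact K)
    (F : Finset κ) : IsClosed (upperCylinder K F) := by
  simpa [upperCylinder] using hK.isClosed_setOf_exists_forall_le F Subtype.val

/-- A point lying in all the upper cylinders of a compact set dominates a point of that set. -/
theorem IsCompact.iInter_upperCylinder_subset {κ X : Type*} [TopologicalSpace X]
    [PartialOrder X] [OrderClosedTopology X] {K : Set (κ → X)} (hK : IsCompact K) :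
    ⋂ F, upperCylinder K F ⊆ (upperClosure K : Set (κ → X)) := by
  intro x hx
  obtain ⟨k, hkK, hk⟩ := hK.inter_iInter_nonempty (fun j : κ => {k | k j ≤ x j})
    (fun j => isClosed_le (by fun_prop) (by fun_prop)) fun F => by
      obtain ⟨k, hkK, hk⟩ := mem_iInter.1 hx F
      exact ⟨k, hkK, by simpa using hk⟩
  exact ⟨k, hkK, fun j => mem_iInter.1 hk j⟩

theorem subset_upperCylinder {κ X : Type*} [Preorder X] (K : Set (κ → X)) (F : Finset κ) :
    K ⊆ upperCylinder K F :=
  fun k hk => ⟨k, hk, fun _ _ => le_rfl⟩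

theorem PosAssoc.measure_mul_le_measure_inter {Ω ι X : Type*} [MeasurableSpace Ω]
    [MeasurableSpace X] [Preorder X] {P : Measure Ω} [IsProbabilityMeasure P]
    {Xs : ι → Ω → X} (h : PosAssoc P Xs) (hmeas : ∀ i, Measurable (Xs i)) (J : Set ι)
    {A B : Set (J → X)} (hA : MeasurableSet A) (hAu : IsUpperSet A)
    (hB : MeasurableSet B) (hBu : IsUpperSet B) :
    P ((fun ω (j : J) => Xs j ω) ⁻¹' A) * P ((fun ω (j : J) => Xs j ω) ⁻¹' B) ≤
      P ((fun ω (j : J) => Xs j ω) ⁻¹' (A ∩ B)) := by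
  set φ : Ω → J → X := fun ω j => Xs j ω
  have hφ : Measurable φ := measurable_pi_lambda _ fun j => hmeas j
  have mono : ∀ {C : Set (J → X)}, IsUpperSet C → Monotone (C.indicator (1 : (J → X) → ℝ)) := by
    intro C hC x y hxy
    by_cases hx : x ∈ C
    · simp [hx, hC hxy hx]
    · rw [indicator_of_notMem hx]
      exact indicator_nonneg (fun _ _ => zero_le_one) y
  have bdd : ∀ C : Set (J → X), ∃ c, ∀ x, |C.indicator (1 : (J → X) → ℝ) x| ≤ c := by
    refine fun C => ⟨1, fun x => ?_⟩
    by_cases hx : x ∈ C <;> simp [hx]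
  have int : ∀ {C : Set (J → X)}, MeasurableSet C →
      ∫ ω, C.indicator (1 : (J → X) → ℝ) (φ ω) ∂P = P.real (φ ⁻¹' C) := by
    intro C hC
    rw [← integral_indicator_one (hφ hC)]
    rfl
  have key := h J (A.indicator 1) (B.indicator 1) (measurable_one.indicator hA) (mono hAu) (bdd A)
    (measurable_one.indicator hB) (mono hBu) (bdd B)
  have hprod : ∀ ω, A.indicator (1 : (J → X) → ℝ) (φ ω) * B.indicator (1 : (J → X) → ℝ) (φ ω) =
      (A ∩ B).indicator (1 : (J → X) → ℝ) (φ ω) := fun ω => by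
    rw [inter_indicator_one, Pi.mul_apply]
  change (∫ ω, A.indicator (1 : (J → X) → ℝ) (φ ω) ∂P) *
    ∫ ω, B.indicator (1 : (J → X) → ℝ) (φ ω) ∂P ≤
    ∫ ω, A.indicator (1 : (J → X) → ℝ) (φ ω) * B.indicator (1 : (J → X) → ℝ) (φ ω) ∂P at key
  simp only [hprod] at key
  rw [int hA, int hB, int (hA.inter hB)] at key
  rwa [measureReal_def, measureReal_def, measureReal_def, ← ENNReal.toReal_mul,
    ENNReal.toReal_le_toReal (by finiteness) (by finiteness)] at key

/-- Comparing two measures on superlevel sets suffices to compare integrals. -/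
theorem mul_lintegral_ofReal_le_of_measure_lt {Y : Type*} [MeasurableSpace Y] {μ ν : Measure Y}
    {c : ℝ≥0∞} (hc : c ≠ ∞) {f : Y → ℝ} (hf : Measurable f) (hf0 : ∀ y, 0 ≤ f y)
    (h : ∀ t, c * μ {y | t < f y} ≤ ν {y | t < f y}) :
    c * ∫⁻ y, ENNReal.ofReal (f y) ∂μ ≤ ∫⁻ y, ENNReal.ofReal (f y) ∂ν := by
  rw [lintegral_eq_lintegral_meas_lt μ (ae_of_all _ hf0) hf.aemeasurable,
    lintegral_eq_lintegral_meas_lt ν (ae_of_all _ hf0) hf.aemeasurable,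
    ← lintegral_const_mul' _ _ hc]
  exact lintegral_mono fun t => h t

/-- If a finite measure is positively correlated on upper sets, then it is positively correlated
on nonnegative increasing functions. -/
theorem lintegral_mul_lintegral_le_of_isUpperSet {Y : Type*} [MeasurableSpace Y] [Preorder Y]
    {μ : Measure Y} [IsFiniteMeasure μ]
    (h : ∀ A B : Set Y, MeasurableSet A → IsUpperSet A → MeasurableSet B → IsUpperSet B →
      μ A * μ B ≤ μ (A ∩ B))
    {f g : Y → ℝ} (hf : Measurable f) (hfm : Monotone f) (hf0 : ∀ y, 0 ≤ f y)
    (hfi : Integrable f μ) (hg : Measurable g) (hgm : Monotone g) (hg0 : ∀ y, 0 ≤ g y) :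
    (∫⁻ y, ENNReal.ofReal (f y) ∂μ) * ∫⁻ y, ENNReal.ofReal (g y) ∂μ ≤
      ∫⁻ y, ENNReal.ofReal (f y) * ENNReal.ofReal (g y) ∂μ := by
  have upper : ∀ {u : Y → ℝ}, Monotone u → ∀ t, IsUpperSet {y | t < u y} :=
    fun hu t _ _ hxy hx => lt_of_lt_of_le hx (hu hxy)
  have hset : ∀ B, MeasurableSet B → IsUpperSet B →
      (∫⁻ y, ENNReal.ofReal (f y) ∂μ) * μ B ≤ ∫⁻ y in B, ENNReal.ofReal (f y) ∂μ := by
    intro B hB hBu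
    rw [mul_comm]
    refine mul_lintegral_ofReal_le_of_measure_lt (by finiteness) hf hf0 fun t => ?_
    have hm : MeasurableSet {y | t < f y} := measurableSet_lt measurable_const hf
    rw [Measure.restrict_apply hm, mul_comm]
    exact h _ _ hm (upper hfm t) hB hBu
  have hfin : ∫⁻ y, ENNReal.ofReal (f y) ∂μ ≠ ∞ := by
    rw [← ofReal_integral_eq_lintegral_ofReal hfi (ae_of_all _ hf0)]
    exact ENNReal.ofReal_ne_top
  have key := mul_lintegral_ofReal_le_of_measure_lt (μ := μ)
    (ν := μ.withDensity fun y => ENNReal.ofReal (f y)) hfin hg hg0 fun t => by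
      have hm : MeasurableSet {y | t < g y} := measurableSet_lt measurable_const hg
      rw [withDensity_apply _ hm]
      exact hset _ hm (upper hgm t)
  rwa [lintegral_withDensity_eq_lintegral_mul _ hf.ennreal_ofReal hg.ennreal_ofReal] at key

theorem integral_mul_integral_le_of_isUpperSet {Y : Type*} [MeasurableSpace Y] [Preorder Y]
    {μ : Measure Y} [IsProbabilityMeasure μ]
    (h : ∀ A B : Set Y, MeasurableSet A → IsUpperSet A → MeasurableSet B → IsUpperSet B →
      μ A * μ B ≤ μ (A ∩ B))
    {f g : Y → ℝ} (hf : Measurable f) (hfm : Monotone f) (hfb : ∃ C, ∀ y, |f y| ≤ C)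
    (hg : Measurable g) (hgm : Monotone g) (hgb : ∃ C, ∀ y, |g y| ≤ C) :
    (∫ y, f y ∂μ) * ∫ y, g y ∂μ ≤ ∫ y, f y * g y ∂μ := by
  obtain ⟨C, hC⟩ := hfb
  obtain ⟨D, hD⟩ := hgb
  have hfi : Integrable f μ := .of_bound hf.aestronglyMeasurable C (ae_of_all _ hC)
  have hgi : Integrable g μ := .of_bound hg.aestronglyMeasurable D (ae_of_all _ hD)
  have hfgi : Integrable (fun y => f y * g y) μ :=
    hgi.bdd_mul hf.aestronglyMeasurable (ae_of_all _ hC)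
  have hf0 : ∀ y, 0 ≤ f y + C := fun y => by linarith [neg_le_of_abs_le (hC y)]
  have hg0 : ∀ y, 0 ≤ g y + D := fun y => by linarith [neg_le_of_abs_le (hD y)]
  have hexp : ∀ y, (f y + C) * (g y + D) = f y * g y + D * f y + C * g y + C * D :=
    fun y => by ring
  have hi : Integrable (fun y => (f y + C) * (g y + D)) μ := by
    simp only [hexp]
    fun_prop
  have hfCi : Integrable (fun y => f y + C) μ := by fun_prop
  have hgDi : Integrable (fun y => g y + D) μ := by fun_prop
  have key := lintegral_mul_lintegral_le_of_isUpperSet h (hf.add_const C) (hfm.add_const C) hf0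
    hfCi (hg.add_const D) (hgm.add_const D) hg0
  simp only [← ENNReal.ofReal_mul (hf0 _)] at key
  rw [← ofReal_integral_eq_lintegral_ofReal hfCi (ae_of_all _ hf0),
    ← ofReal_integral_eq_lintegral_ofReal hgDi (ae_of_all _ hg0),
    ← ofReal_integral_eq_lintegral_ofReal hi (ae_of_all _ fun y => mul_nonneg (hf0 y) (hg0 y)),
    ← ENNReal.ofReal_mul (integral_nonneg hf0),
    ENNReal.ofReal_le_ofReal_iff (integral_nonneg fun y => mul_nonneg (hf0 y) (hg0 y))] at key
  simp only [hexp] at key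
  rw [integral_add hfi (by fun_prop), integral_add hgi (by fun_prop),
    integral_add (by fun_prop) (by fun_prop), integral_add (by fun_prop) (by fun_prop),
    integral_add hfgi (by fun_prop), integral_const_mul, integral_const_mul] at key
  simp only [integral_const, probReal_univ, one_smul] at key
  linarith

/-- A finite measure on a countable power of a partially ordered Polish space which is positively
correlated on upper cylinders is positively correlated on all measurable upper sets. -/
theorem measure_mul_le_measure_inter_of_upperCylinder {κ X : Type*} [Countable κ]
    [TopologicalSpace X] [PolishSpace X] [MeasurableSpace X] [BorelSpace X]
    [PartialOrder X] [OrderClosedTopology X] {μ : Measure (κ → X)} [IsFiniteMeasure μ]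
    (h : ∀ (K L : Set (κ → X)) (F : Finset κ), IsCompact K → IsCompact L →
      μ (upperCylinder K F) * μ (upperCylinder L F) ≤ μ (upperCylinder K F ∩ upperCylinder L F))
    {A B : Set (κ → X)} (hA : MeasurableSet A) (hAu : IsUpperSet A)
    (hB : MeasurableSet B) (hBu : IsUpperSet B) :
    μ A * μ B ≤ μ (A ∩ B) := by
  have compact : ∀ K L : Set (κ → X), K ⊆ A → IsCompact K → L ⊆ B → IsCompact L →
      μ K * μ L ≤ μ (A ∩ B) := by
    intro K L hKA hK hLB hL
    have hlim := tendsto_measure_iInter_atTop (μ := μ)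
      (s := fun F => upperCylinder K F ∩ upperCylinder L F)
      (fun F => ((hK.isClosed_upperCylinder F).inter
        (hL.isClosed_upperCylinder F)).measurableSet.nullMeasurableSet)
      (fun F G hFG => inter_subset_inter (upperCylinder_antitone K hFG)
        (upperCylinder_antitone L hFG)) ⟨∅, by finiteness⟩
    refine (ge_of_tendsto' hlim fun F => ?_).trans (measure_mono ?_)
    · exact (mul_le_mul' (measure_mono (subset_upperCylinder K F))
        (measure_mono (subset_upperCylinder L F))).trans (h K L F hK hL)
    · rw [iInter_inter_distrib]
      exact inter_subset_inter
        (hK.iInter_upperCylinder_subset.trans (upperClosure_min hKA hAu))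
        (hL.iInter_upperCylinder_subset.trans (upperClosure_min hLB hBu))
  refine ENNReal.mul_le_of_forall_lt fun a ha b hb => ?_
  obtain ⟨K, hKA, hK, haK⟩ := hA.exists_lt_isCompact ha
  obtain ⟨L, hLB, hL, hbL⟩ := hB.exists_lt_isCompact hb
  exact (mul_le_mul' haK.le hbL.le).trans (compact K L hKA hK hLB hL)

/-- If every finite subfamily of a countable family of random elements of a partially
ordered Polish space with closed partial order is positively associated, then the whole
family is positively associated. -/
theorem posAssoc_of_finite_posAssoc
    {Ω ι X : Type*} [MeasurableSpace Ω] [Countable ι]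
    [TopologicalSpace X] [PolishSpace X] [MeasurableSpace X] [BorelSpace X]
    [PartialOrder X] [OrderClosedTopology X]
    (P : Measure Ω) [IsProbabilityMeasure P]
    (Xs : ι → Ω → X) (hmeas : ∀ i, Measurable (Xs i))
    (hfin : ∀ F : Finset ι, PosAssoc P (fun (i : F) ω => Xs i.1 ω)) :
    PosAssoc P Xs := by
  intro J f g hf hfm hfb hg hgm hgb
  have hφ : Measurable fun ω (j : J) => Xs j ω := measurable_pi_lambda _ fun j => hmeas j
  have : IsProbabilityMeasure (P.map fun ω (j : J) => Xs j ω) :=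
    Measure.isProbabilityMeasure_map hφ.aemeasurable
  have cyl : ∀ (K L : Set (J → X)) (F : Finset J), IsCompact K → IsCompact L →
      P.map (fun ω (j : J) => Xs j ω) (upperCylinder K F) *
        P.map (fun ω (j : J) => Xs j ω) (upperCylinder L F) ≤
      P.map (fun ω (j : J) => Xs j ω) (upperCylinder K F ∩ upperCylinder L F) := by
    intro K L F hK hL
    have hKc := hK.isClosed_upperCylinder F
    have hLc := hL.isClosed_upperCylinder F
    rw [Measure.map_apply hφ hKc.measurableSet, Measure.map_apply hφ hLc.measurableSet,
      Measure.map_apply hφ (hKc.inter hLc).measurableSet]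
    let G : Finset ι := F.map (Function.Embedding.subtype _)
    let e : F → ↥(univ : Set ↥G) := fun j =>
      ⟨⟨j.1.1, Finset.mem_map_of_mem (Function.Embedding.subtype _) j.2⟩, mem_univ _⟩
    let T : Set (J → X) → Set (↥(univ : Set ↥G) → X) := fun K =>
      {z | ∃ k ∈ K, ∀ j : F, k j ≤ z (e j)}
    have hT : ∀ {K}, IsCompact K → MeasurableSet (T K) := fun hK =>
      (hK.isClosed_setOf_exists_forall_le F e).measurableSet
    have hTu : ∀ K, IsUpperSet (T K) := fun K x y hxy ⟨k, hk, hle⟩ =>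
      ⟨k, hk, fun j => (hle j).trans (hxy _)⟩
    have hpre : ∀ K, (fun ω (j : J) => Xs j ω) ⁻¹' upperCylinder K F =
        (fun ω (i : ↥(univ : Set ↥G)) => Xs i.1.1 ω) ⁻¹' T K := by
      intro K
      ext ω
      simp [upperCylinder, T, e]
    rw [preimage_inter, hpre, hpre, ← preimage_inter]
    exact (hfin G).measure_mul_le_measure_inter (fun i => hmeas i) univ (hT hK) (hTu K) (hT hL)
      (hTu L)
  have key := integral_mul_integral_le_of_isUpperSet
    (fun A B hA hAu hB hBu => measure_mul_le_measure_inter_of_upperCylinder cyl hA hAu hB hBu)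
    hf hfm hfb hg hgm hgb
  rwa [integral_map hφ.aemeasurable hf.aestronglyMeasurable,
    integral_map hφ.aemeasurable hg.aestronglyMeasurable,
    integral_map hφ.aemeasurable (hf.fun_mul hg).aestronglyMeasurable] at key
end

section
/- Let (X_i)_{i∈I} and (Y_j)_{j∈J} be two families of random elements of a partially ordered Polish space X with closed partial order, with I and J countable. Suppose that for all finite subsets I' ⊂ I and J' ⊂ J and all bounded measurable coordinatewise nondecreasing functions f : X^{I'} → ℝ and g : X^{J'} → ℝ, E[f(X_{I'}) g(Y_{J'})] ≤ E[f(X_{I'})] E[g(Y_{J'})]. Then for all bounded measurable coordinatewise nondecreasing functions f : X^I → ℝ and g : X^J → ℝ, E[f(X_I) g(Y_J)] ≤ E[f(X_I)] E[g(Y_J)]. -/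
open MeasureTheory

theorem IsCompact.isClosed_coe_upperClosure {E : Type*} [TopologicalSpace E] [PartialOrder E]
    [OrderClosedTopology E] {K : Set E} (hK : IsCompact K) :
    IsClosed (upperClosure K : Set E) := by
  have : CompactSpace K := isCompact_iff_compactSpace.mp hK
  have hcl : IsClosed {p : K × E | (p.1 : E) ≤ p.2} :=
    isClosed_le (continuous_subtype_val.comp continuous_fst) continuous_snd
  convert isClosedMap_snd_of_compactSpace _ hcl
  ext x
  simp [mem_upperClosure]

/-- The upper closure of a compact subset of a product is the intersection of the cylinders over
the upper closures of its finite-dimensional projections. -/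
theorem IsCompact.iInter_preimage_restrict_upperClosure {ι X : Type*} [TopologicalSpace X]
    [PartialOrder X] [OrderClosedTopology X] {K : Set (ι → X)} (hK : IsCompact K) :
    ⋂ S : Finset ι, S.restrict ⁻¹' (upperClosure (S.restrict '' K) : Set (S → X)) =
      (upperClosure K : Set (ι → X)) := by
  classical
  refine Set.Subset.antisymm (fun x hx => ?_) fun x hx => ?_
  · have hcl (S : Finset ι) : IsClosed {k : ι → X | ∀ i ∈ S, k i ≤ x i} := by
      simp only [Set.ofPred_forall]
      exact isClosed_biInter fun i _ => isClosed_le (continuous_apply i) continuous_const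
    obtain ⟨k, hk⟩ := IsCompact.nonempty_iInter_of_directed_nonempty_isCompact_isClosed
      (fun S : Finset ι => K ∩ {k | ∀ i ∈ S, k i ≤ x i})
      (fun S T => ⟨S ∪ T,
        fun k hk => ⟨hk.1, fun i hi => hk.2 i (Finset.mem_union_left _ hi)⟩,
        fun k hk => ⟨hk.1, fun i hi => hk.2 i (Finset.mem_union_right _ hi)⟩⟩)
      (fun S => by
        obtain ⟨_, ⟨k, hkK, rfl⟩, hkx⟩ := mem_upperClosure.mp (Set.mem_iInter.mp hx S)
        exact ⟨k, hkK, fun i hi => hkx ⟨i, hi⟩⟩)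
      (fun S => hK.inter_right (hcl S))
      (fun S => hK.isClosed.inter (hcl S))
    rw [Set.mem_iInter] at hk
    exact mem_upperClosure.mpr ⟨k, (hk ∅).1, fun i => (hk {i}).2 i (Finset.mem_singleton_self i)⟩
  · obtain ⟨k, hkK, hkx⟩ := mem_upperClosure.mp hx
    exact Set.mem_iInter.mpr fun S =>
      mem_upperClosure.mpr ⟨S.restrict k, Set.mem_image_of_mem _ hkK, fun i => hkx i⟩

/-- Every measurable upper set in a countable product is approximated in measure by a cylinder
over a finite-dimensional measurable upper set. -/
theorem IsUpperSet.exists_cylinder_approx {ι X : Type*} [Countable ι]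
    [TopologicalSpace X] [PolishSpace X] [MeasurableSpace X] [BorelSpace X]
    [PartialOrder X] [OrderClosedTopology X] (μ : Measure (ι → X)) [IsFiniteMeasure μ]
    {A : Set (ι → X)} (hA : IsUpperSet A) (hAm : MeasurableSet A) {ε : ℝ} (hε : 0 < ε) :
    ∃ (S : Finset ι) (U : Set (S → X)), MeasurableSet U ∧ IsUpperSet U ∧
      μ.real (A \ S.restrict ⁻¹' U) ≤ ε ∧ μ.real (S.restrict ⁻¹' U) ≤ μ.real A + ε := by
  obtain ⟨K, hKA, hK, hKε⟩ := hAm.exists_isCompact_sdiff_lt (μ := μ) (measure_ne_top μ A)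
    (ε := ENNReal.ofReal ε) (by simpa using hε)
  have hU (S : Finset ι) : MeasurableSet (upperClosure (S.restrict '' K) : Set (S → X)) :=
    (hK.image S.continuous_restrict).isClosed_coe_upperClosure.measurableSet
  have hlim := tendsto_measure_iInter_atTop (μ := μ)
    (s := fun S : Finset ι => S.restrict ⁻¹' (upperClosure (S.restrict '' K) : Set (S → X)))
    (fun S => (S.measurable_restrict (hU S)).nullMeasurableSet)
    (fun S T hST x hx => by
      obtain ⟨_, ⟨k, hkK, rfl⟩, hkx⟩ := mem_upperClosure.mp hx
      exact mem_upperClosure.mpr ⟨S.restrict k, Set.mem_image_of_mem _ hkK,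
        fun i => hkx ⟨i, hST i.2⟩⟩)
    ⟨∅, measure_ne_top _ _⟩
  rw [hK.iInter_preimage_restrict_upperClosure] at hlim
  have hle : μ (upperClosure K : Set (ι → X)) ≤ μ A :=
    measure_mono (upperClosure_min hKA hA)
  have hlt : μ (upperClosure K : Set (ι → X)) < μ A + ENNReal.ofReal ε :=
    hle.trans_lt (ENNReal.lt_add_right (measure_ne_top _ _) (by simpa using hε))
  obtain ⟨S, hS⟩ := (hlim.eventually_lt_const hlt).exists
  refine ⟨S, _, hU S, (upperClosure _).upper, ?_, ?_⟩
  · refine ENNReal.toReal_le_of_le_ofReal hε.le ((measure_mono ?_).trans hKε.le)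
    exact Set.sdiff_subset_sdiff_right fun k hk => subset_upperClosure (Set.mem_image_of_mem _ hk)
  · have := ENNReal.toReal_mono (by simp) hS.le
    rwa [ENNReal.toReal_add (by simp) (by simp), ENNReal.toReal_ofReal hε.le] at this

/-- If `v` integrates to zero and has nonpositive integral over the preimage of every measurable
upper set, then it has nonpositive integral against every bounded measurable monotone function. -/
theorem integral_monotone_mul_nonpos {Ω E : Type*} [MeasurableSpace Ω] [MeasurableSpace E]
    [Preorder E] {P : Measure Ω} [IsFiniteMeasure P] {Z : Ω → E} (hZ : Measurable Z)
    {v : Ω → ℝ} (hv : Integrable v P) (hv0 : ∫ ω, v ω ∂P = 0)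
    (hup : ∀ A : Set E, MeasurableSet A → IsUpperSet A → ∫ ω in Z ⁻¹' A, v ω ∂P ≤ 0)
    {f : E → ℝ} (hf : Measurable f) (hmono : Monotone f) (hbdd : ∃ C, ∀ x, |f x| ≤ C) :
    ∫ ω, f (Z ω) * v ω ∂P ≤ 0 := by
  obtain ⟨C, hC⟩ := hbdd
  have hint : Integrable (fun ω => f (Z ω) * v ω) P :=
    hv.bdd_mul (hf.comp hZ).aestronglyMeasurable (.of_forall fun ω => hC (Z ω))
  have key (n : ℕ) : n * ∫ ω, f (Z ω) * v ω ∂P ≤ ∫ ω, |v ω| ∂P := by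
    set A : ℕ → Set E := fun k => {x | (k + 1 : ℝ) ≤ n * (f x + C)} with hA
    have hAm (k : ℕ) : MeasurableSet (A k) :=
      measurableSet_le measurable_const ((hf.add_const C).const_mul _)
    have hAup (k : ℕ) : IsUpperSet (A k) := fun x y hxy hx =>
      hx.out.trans (by gcongr; exact hmono hxy)
    set N := ⌊n * (2 * C)⌋₊ with hN
    have hnn (x : E) : 0 ≤ n * (f x + C) :=
      mul_nonneg n.cast_nonneg (by linarith [neg_le_of_abs_le (hC x)])
    have hstep (x : E) :
        ∑ k ∈ Finset.range N, (A k).indicator (fun _ => (1 : ℝ)) x = ⌊n * (f x + C)⌋₊ := by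
      have hmem (k : ℕ) : x ∈ A k ↔ k < ⌊n * (f x + C)⌋₊ := by
        rw [← Nat.succ_le_iff, Nat.le_floor_iff (hnn x)]
        simp [hA]
      have hle : ⌊n * (f x + C)⌋₊ ≤ N :=
        Nat.floor_mono (by gcongr; linarith [le_of_abs_le (hC x)])
      have : (Finset.range N).filter (· < ⌊n * (f x + C)⌋₊) =
          Finset.range ⌊n * (f x + C)⌋₊ := by
        ext k
        simp only [Finset.mem_filter, Finset.mem_range]
        omega
      simp only [Set.indicator_apply, hmem, Finset.sum_boole, this, Finset.card_range]
    have hindic (k : ℕ) (ω : Ω) : (A k).indicator (fun _ => (1 : ℝ)) (Z ω) * v ω =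
        (Z ⁻¹' A k).indicator v ω := by
      by_cases h : Z ω ∈ A k <;> simp [h]
    have hindint (k : ℕ) : Integrable ((Z ⁻¹' A k).indicator v) P :=
      hv.indicator (hZ (hAm k))
    have hsum : ∫ ω, ∑ k ∈ Finset.range N, (Z ⁻¹' A k).indicator v ω ∂P ≤ 0 := by
      rw [integral_finsetSum _ fun k _ => hindint k]
      refine Finset.sum_nonpos fun k _ => ?_
      rw [integral_indicator (hZ (hAm k))]
      exact hup _ (hAm k) (hAup k)
    have hpt (ω : Ω) : n * (f (Z ω) * v ω) + n * C * v ω ≤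
        ∑ k ∈ Finset.range N, (Z ⁻¹' A k).indicator v ω + |v ω| := by
      simp only [← hindic, ← Finset.sum_mul, hstep]
      have h1 := Nat.floor_le (hnn (Z ω))
      have h2 := (Nat.lt_floor_add_one (n * (f (Z ω) + C))).le
      have h3 : (n * (f (Z ω) + C) - ⌊n * (f (Z ω) + C)⌋₊) * v ω ≤ 1 * |v ω| :=
        (mul_le_mul_of_nonneg_left (le_abs_self _) (by linarith)).trans
          (mul_le_mul_of_nonneg_right (by linarith) (abs_nonneg _))
      linarith
    have hmain := integral_mono
      ((hint.const_mul (n : ℝ)).add (hv.const_mul (n * C)))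
      ((integrable_finsetSum (Finset.range N) fun k _ => hindint k).add hv.abs) hpt
    rw [integral_add' (hint.const_mul _) (hv.const_mul _), integral_const_mul,
      integral_const_mul, hv0, integral_add'
      (integrable_finsetSum (Finset.range N) fun k _ => hindint k) hv.abs] at hmain
    linarith
  by_contra! hpos
  obtain ⟨n, hn⟩ := exists_nat_gt ((∫ ω, |v ω| ∂P) / ∫ ω, f (Z ω) * v ω ∂P)
  rw [div_lt_iff₀ hpos] at hn
  exact (key n).not_gt hn

/-- Negative correlation of upper-set events for two random elements implies the negative
covariance inequality for bounded measurable monotone functions. -/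
theorem integral_mul_le_of_upperSet {Ω E F : Type*} [MeasurableSpace Ω] [MeasurableSpace E]
    [MeasurableSpace F] [Preorder E] [Preorder F] {P : Measure Ω} [IsProbabilityMeasure P]
    {Z : Ω → E} {W : Ω → F} (hZ : Measurable Z) (hW : Measurable W)
    (hup : ∀ (A : Set E) (B : Set F), MeasurableSet A → IsUpperSet A → MeasurableSet B →
      IsUpperSet B → P.real (Z ⁻¹' A ∩ W ⁻¹' B) ≤ P.real (Z ⁻¹' A) * P.real (W ⁻¹' B))
    {f : E → ℝ} {g : F → ℝ} (hf : Measurable f) (hfm : Monotone f) (hfb : ∃ C, ∀ x, |f x| ≤ C)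
    (hg : Measurable g) (hgm : Monotone g) (hgb : ∃ C, ∀ x, |g x| ≤ C) :
    ∫ ω, f (Z ω) * g (W ω) ∂P ≤ (∫ ω, f (Z ω) ∂P) * ∫ ω, g (W ω) ∂P := by
  have hfi : Integrable (fun ω => f (Z ω)) P := by
    obtain ⟨C, hC⟩ := hfb
    exact .of_bound (hf.comp hZ).aestronglyMeasurable C (.of_forall fun ω => hC _)
  have hgi : Integrable (fun ω => g (W ω)) P := by
    obtain ⟨C, hC⟩ := hgb
    exact .of_bound (hg.comp hW).aestronglyMeasurable C (.of_forall fun ω => hC _)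
  have hfgi : Integrable (fun ω => f (Z ω) * g (W ω)) P := by
    obtain ⟨C, hC⟩ := hfb
    exact hgi.bdd_mul (hf.comp hZ).aestronglyMeasurable (.of_forall fun ω => hC (Z ω))
  have hset (A : Set E) (hA : MeasurableSet A) (hAu : IsUpperSet A) :
      ∫ ω in Z ⁻¹' A, (g (W ω) - ∫ ω, g (W ω) ∂P) ∂P ≤ 0 := by
    have hi : Integrable ((Z ⁻¹' A).indicator fun _ => (1 : ℝ)) P :=
      (integrable_const 1).indicator (hZ hA)
    have h := integral_monotone_mul_nonpos (P := P) hW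
      (v := fun ω => (Z ⁻¹' A).indicator (fun _ => (1 : ℝ)) ω - P.real (Z ⁻¹' A))
      (hi.sub (integrable_const _))
      (by
        rw [integral_sub hi (integrable_const _), integral_indicator (hZ hA)]
        simp)
      (fun B hB hBu => by
        rw [integral_sub hi.integrableOn (integrable_const _), setIntegral_indicator (hZ hA)]
        have := hup A B hA hAu hB hBu
        rw [Set.inter_comm] at this
        simp only [integral_const, smul_eq_mul, measureReal_restrict_apply_univ, mul_one]
        linarith)
      hg hgm hgb
    have heq : ∀ ω, g (W ω) * ((Z ⁻¹' A).indicator (fun _ => (1 : ℝ)) ω - P.real (Z ⁻¹' A)) =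
        (Z ⁻¹' A).indicator (fun ω => g (W ω)) ω - g (W ω) * P.real (Z ⁻¹' A) := fun ω => by
      by_cases hω : ω ∈ Z ⁻¹' A
      · simp only [Set.indicator_of_mem hω]; ring
      · simp only [Set.indicator_of_notMem hω]; ring
    simp only [heq] at h
    rw [integral_sub (hgi.indicator (hZ hA)) (hgi.mul_const _), integral_indicator (hZ hA),
      integral_mul_const] at h
    rw [integral_sub hgi.integrableOn (integrable_const _)]
    simp only [integral_const, smul_eq_mul, measureReal_restrict_apply_univ]
    linarith
  have h := integral_monotone_mul_nonpos hZ (hgi.sub (integrable_const _))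
    (by simp [integral_sub hgi]) hset hf hfm hfb
  simp only [Pi.sub_apply, mul_sub] at h
  rw [integral_sub hfgi (hfi.mul_const _), integral_mul_const] at h
  linarith

theorem IsUpperSet.monotone_indicator_one {E : Type*} [Preorder E] {D : Set E}
    (hD : IsUpperSet D) : Monotone (D.indicator fun _ => (1 : ℝ)) := fun x y hxy => by
  by_cases hx : x ∈ D
  · simp [hx, hD hxy hx]
  · simp only [Set.indicator_of_notMem hx]
    exact Set.indicator_nonneg (fun _ _ => zero_le_one) _

theorem exists_abs_indicator_one_le {E : Type*} (D : Set E) :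
    ∃ C, ∀ x, |D.indicator (fun _ => (1 : ℝ)) x| ≤ C :=
  ⟨1, fun x => by by_cases hx : x ∈ D <;> simp [hx]⟩

/-- If two countable families `(Xs i)_{i ∈ ι}`, `(Ys j)_{j ∈ κ}` of random elements of a
partially ordered Polish space with closed partial order satisfy the negative covariance
inequality `E[f(X_{I'}) g(Y_{J'})] ≤ E[f(X_{I'})] E[g(Y_{J'})]` for all finite subsets
`I' ⊆ ι`, `J' ⊆ κ` and all bounded measurable coordinatewise nondecreasing `f`, `g`,
then the same inequality holds for the full (countable) families. -/
theorem negAssoc_two_families_of_finite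
    {Ω ι κ X : Type*} [MeasurableSpace Ω] [Countable ι] [Countable κ]
    [TopologicalSpace X] [PolishSpace X] [MeasurableSpace X] [BorelSpace X]
    [PartialOrder X] [OrderClosedTopology X]
    (P : Measure Ω) [IsProbabilityMeasure P]
    (Xs : ι → Ω → X) (Ys : κ → Ω → X)
    (hXmeas : ∀ i, Measurable (Xs i)) (hYmeas : ∀ j, Measurable (Ys j))
    (hfin : ∀ (I' : Finset ι) (J' : Finset κ)
        (f : (I' → X) → ℝ) (g : (J' → X) → ℝ),
      Measurable f → Monotone f → (∃ C, ∀ x, |f x| ≤ C) →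
      Measurable g → Monotone g → (∃ C, ∀ x, |g x| ≤ C) →
      ∫ ω, f (fun i => Xs i.1 ω) * g (fun j => Ys j.1 ω) ∂P ≤
        (∫ ω, f (fun i => Xs i.1 ω) ∂P) * ∫ ω, g (fun j => Ys j.1 ω) ∂P) :
    ∀ (f : (ι → X) → ℝ) (g : (κ → X) → ℝ),
      Measurable f → Monotone f → (∃ C, ∀ x, |f x| ≤ C) →
      Measurable g → Monotone g → (∃ C, ∀ x, |g x| ≤ C) →
      ∫ ω, f (fun i => Xs i ω) * g (fun j => Ys j ω) ∂P ≤
        (∫ ω, f (fun i => Xs i ω) ∂P) * ∫ ω, g (fun j => Ys j ω) ∂P := by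
  intro f g hf hfm hfb hg hgm hgb
  have hX : Measurable fun ω i => Xs i ω := measurable_pi_lambda _ hXmeas
  have hY : Measurable fun ω j => Ys j ω := measurable_pi_lambda _ hYmeas
  refine integral_mul_le_of_upperSet hX hY (fun A B hA hAu hB hBu => ?_) hf hfm hfb hg hgm hgb
  have := Measure.isProbabilityMeasure_map (μ := P) hX.aemeasurable
  have := Measure.isProbabilityMeasure_map (μ := P) hY.aemeasurable
  set a := P.real ((fun ω i => Xs i ω) ⁻¹' A) with ha
  set b := P.real ((fun ω j => Ys j ω) ⁻¹' B) with hb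
  have key (ε : ℝ) (hε : 0 < ε) :
      P.real ((fun ω i => Xs i ω) ⁻¹' A ∩ (fun ω j => Ys j ω) ⁻¹' B) ≤
        (a + ε) * (b + ε) + 2 * ε := by
    obtain ⟨S, U, hU, hUu, hU1, hU2⟩ :=
      hAu.exists_cylinder_approx (P.map fun ω i => Xs i ω) hA hε
    obtain ⟨T, V, hV, hVu, hV1, hV2⟩ :=
      hBu.exists_cylinder_approx (P.map fun ω j => Ys j ω) hB hε
    have hSU := S.measurable_restrict (X := fun _ => X) hU
    have hTV := T.measurable_restrict (X := fun _ => X) hV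
    rw [map_measureReal_apply hX (hA.diff hSU)] at hU1
    rw [map_measureReal_apply hX hSU, map_measureReal_apply hX hA] at hU2
    rw [map_measureReal_apply hY (hB.diff hTV)] at hV1
    rw [map_measureReal_apply hY hTV, map_measureReal_apply hY hB] at hV2
    set U' : Set Ω := (fun ω i => Xs i ω) ⁻¹' (S.restrict ⁻¹' U) with hU'
    set V' : Set Ω := (fun ω j => Ys j ω) ⁻¹' (T.restrict ⁻¹' V) with hV'
    have hcov := hfin S T (U.indicator fun _ => 1) (V.indicator fun _ => 1)
      (measurable_const.indicator hU) hUu.monotone_indicator_one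
      (exists_abs_indicator_one_le U)
      (measurable_const.indicator hV) hVu.monotone_indicator_one
      (exists_abs_indicator_one_le V)
    have e1 : ∀ ω, U.indicator (fun _ => (1 : ℝ)) (fun i => Xs i.1 ω) =
        U'.indicator 1 ω := fun _ => rfl
    have e2 : ∀ ω, V.indicator (fun _ => (1 : ℝ)) (fun j => Ys j.1 ω) =
        V'.indicator 1 ω := fun _ => rfl
    have e3 : ∀ ω, U'.indicator (1 : Ω → ℝ) ω * V'.indicator 1 ω = (U' ∩ V').indicator 1 ω :=
      fun ω => by rw [Set.inter_indicator_one, Pi.mul_apply]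
    simp only [e1, e2, e3] at hcov
    rw [integral_indicator_one ((hX hSU).inter (hY hTV)), integral_indicator_one (hX hSU),
      integral_indicator_one (hY hTV)] at hcov
    calc _ ≤ P.real ((U' ∩ V') ∪ ((fun ω i => Xs i ω) ⁻¹' (A \ S.restrict ⁻¹' U) ∪
              (fun ω j => Ys j ω) ⁻¹' (B \ T.restrict ⁻¹' V))) := by
          refine measureReal_mono fun ω hω => ?_
          by_cases h1 : ω ∈ U'
          · by_cases h2 : ω ∈ V'
            · exact .inl ⟨h1, h2⟩
            · exact .inr (.inr ⟨hω.2, h2⟩)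
          · exact .inr (.inl ⟨hω.1, h1⟩)
      _ ≤ P.real (U' ∩ V') + (ε + ε) :=
          (measureReal_union_le _ _).trans <| add_le_add_right
            ((measureReal_union_le _ _).trans (add_le_add hU1 hV1)) _
      _ ≤ (a + ε) * (b + ε) + 2 * ε := by
          have := mul_le_mul hU2 hV2 measureReal_nonneg (by positivity)
          linarith
  have hlim : Filter.Tendsto (fun ε : ℝ => (a + ε) * (b + ε) + 2 * ε)
      (nhdsWithin 0 (Set.Ioi 0)) (nhds (a * b)) := by
    have : Continuous fun ε : ℝ => (a + ε) * (b + ε) + 2 * ε := by fun_prop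
    simpa using (this.tendsto 0).mono_left nhdsWithin_le_nhds
  exact ge_of_tendsto hlim (eventually_mem_nhdsWithin.mono key)
end
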